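/- arXiv:2006.07561 — 3 statements merged into one kernel-verified Lean document; each statement's English description precedes it below -/
import Mathlib

section
/- Let n ≥ 2 and k ≥ 0 be integers, X an n×k real matrix with 1_n^T X = 0, λ > 0, and y ∈ ℝ^n a vector that is not a scalar multiple of 1_n. Then the marginal likelihood integral evaluates in closed form: ∫₀^∞ ∫_{ℝ^k} ∫_ℝ (2πσ²)^{−n/2} exp(−‖y − β₀1_n − Xβ‖²/(2σ²)) · (λ/(2πσ²))^{k/2} exp(−λ‖β‖²/(2σ²)) · (1/σ²) dβ₀ dβ dσ² = Γ((n−1)/2)·π^{−(n−1)/2}·n^{−1/2}·λ^{k/2}·det(X^T X + λI_k)^{−1/2}·R^{−(n−1)/2}, where ȳ is the mean of the coordinates of y, ỹ = y − ȳ1_n, R = ỹ^T ỹ − ỹ^T X (X^T X + λI_k)^{−1} X^T ỹ, and ‖·‖ is the Euclidean norm. -/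
open MeasureTheory Matrix Real Filter

noncomputable section

lemma exists_fact {k : ℕ} {A : Matrix (Fin k) (Fin k) ℝ} (hA : A.PosDef) :
    ∃ B : Matrix (Fin k) (Fin k) ℝ, A = Bᵀ * B := by
  open scoped MatrixOrder in
  obtain ⟨B, hB⟩ := CStarAlgebra.nonneg_iff_eq_star_mul_self.mp hA.posSemidef.nonneg
  exact ⟨B, by rw [hB, star_eq_conjTranspose, conjTranspose_eq_transpose_of_trivial]⟩

lemma gauss_std {k : ℕ} {c : ℝ} (hc : 0 < c) :
    ∫ b : Fin k → ℝ, Real.exp (-(c * (b ⬝ᵥ b))) = (π / c) ^ ((k : ℝ) / 2) := by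
  have h : ∀ b : Fin k → ℝ, Real.exp (-(c * (b ⬝ᵥ b))) = ∏ i, Real.exp (-c * (b i) ^ 2) := by
    intro b
    rw [← Real.exp_sum]
    congr 1
    rw [← Finset.mul_sum, dotProduct]
    simp [pow_two]
  simp_rw [h]
  rw [integral_fintype_prod_volume_eq_pow (fun x : ℝ => Real.exp (-c * x ^ 2)), integral_gaussian,
    Real.sqrt_eq_rpow, ← Real.rpow_natCast, ← Real.rpow_mul (by positivity)]
  congr 1
  simp; ring

lemma gauss_A {k : ℕ} {A : Matrix (Fin k) (Fin k) ℝ} (hA : A.PosDef) (m : Fin k → ℝ)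
    {c : ℝ} (hc : 0 < c) :
    ∫ b : Fin k → ℝ, Real.exp (-(c * ((b - m) ⬝ᵥ (A *ᵥ (b - m))))) =
      (π / c) ^ ((k : ℝ) / 2) * A.det ^ (-(1 : ℝ) / 2) := by
  rw [integral_sub_right_eq_self (fun b : Fin k → ℝ => Real.exp (-(c * (b ⬝ᵥ (A *ᵥ b))))) m]
  obtain ⟨B, hB⟩ := exists_fact hA
  have hdet : A.det = B.det ^ 2 := by rw [hB, det_mul, det_transpose, sq]
  have hpos := hA.det_pos
  have hB0 : B.det ≠ 0 := by
    intro h; rw [hdet, h] at hpos; simp at hpos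
  have h1 : ∀ b : Fin k → ℝ, b ⬝ᵥ (A *ᵥ b) = (toLin' B b) ⬝ᵥ (toLin' B b) := by
    intro b
    rw [hB, ← mulVec_mulVec, dotProduct_mulVec, vecMul_transpose, toLin'_apply]
  simp_rw [h1]
  have hcont : Continuous (toLin' B) := LinearMap.continuous_of_finiteDimensional _
  have h2 := integral_map (μ := (volume : Measure (Fin k → ℝ))) (φ := toLin' B)
    (f := fun v : Fin k → ℝ => Real.exp (-(c * (v ⬝ᵥ v)))) hcont.measurable.aemeasurable
    (by apply Continuous.aestronglyMeasurable; simp only [dotProduct]; fun_prop)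
  rw [← h2, Real.map_matrix_volume_pi_eq_smul_volume_pi hB0, integral_smul_measure, gauss_std hc,
    ENNReal.toReal_ofReal (abs_nonneg _), smul_eq_mul, mul_comm]
  congr 1
  rw [hdet, ← sq_abs, ← Real.rpow_natCast, ← Real.rpow_mul (abs_nonneg _), abs_inv]
  norm_num
  rw [Real.rpow_neg_one]

lemma inv_gamma {a r : ℝ} (ha : 0 < a) (hr : 0 < r) :
    ∫ s in Set.Ioi (0 : ℝ), s ^ (-a) * (1 / s) * Real.exp (-r / s) = Real.Gamma a * r ^ (-a) := by
  have h := integral_comp_rpow_Ioi (fun t : ℝ => t ^ (a - 1) * Real.exp (-(r * t)))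
    (p := -1) (by norm_num)
  rw [Real.integral_rpow_mul_exp_neg_mul_Ioi ha hr] at h
  rw [Real.rpow_neg hr.le, ← Real.inv_rpow hr.le, mul_comm (Real.Gamma a), ← one_div, ← h]
  refine setIntegral_congr_fun measurableSet_Ioi fun s hs => ?_
  have hs : 0 < s := hs
  simp only [smul_eq_mul]
  rw [← Real.rpow_mul hs.le, Real.rpow_neg_one, abs_neg, abs_one, one_mul, ← mul_assoc,
    ← Real.rpow_add hs, one_div, ← Real.rpow_neg_one s, ← Real.rpow_add hs, Real.rpow_neg_one,
    neg_div, div_eq_mul_inv]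
  congr 2
  ring


lemma posDef_A {n k : ℕ} (X : Matrix (Fin n) (Fin k) ℝ) {lam : ℝ} (hlam : 0 < lam) :
    (Xᵀ * X + lam • (1 : Matrix (Fin k) (Fin k) ℝ)).PosDef := by
  have h := posSemidef_conjTranspose_mul_self X
  rw [conjTranspose_eq_transpose_of_trivial] at h
  exact (Matrix.PosDef.one.smul hlam).posSemidef_add h

lemma complete_sq {n k : ℕ} (X : Matrix (Fin n) (Fin k) ℝ) {lam : ℝ} (hlam : 0 < lam)
    (z : Fin n → ℝ) (A : Matrix (Fin k) (Fin k) ℝ)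
    (hA : A = Xᵀ * X + lam • (1 : Matrix (Fin k) (Fin k) ℝ)) (b : Fin k → ℝ) :
    (z - X *ᵥ b) ⬝ᵥ (z - X *ᵥ b) + lam * (b ⬝ᵥ b) =
      (b - A⁻¹ *ᵥ (Xᵀ *ᵥ z)) ⬝ᵥ (A *ᵥ (b - A⁻¹ *ᵥ (Xᵀ *ᵥ z))) +
        (z ⬝ᵥ z - z ⬝ᵥ (X *ᵥ (A⁻¹ *ᵥ (Xᵀ *ᵥ z)))) := by
  have hPD : A.PosDef := hA ▸ posDef_A X hlam
  set m := A⁻¹ *ᵥ (Xᵀ *ᵥ z) with hm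
  have hAm : A *ᵥ m = Xᵀ *ᵥ z := by
    rw [hm, mulVec_mulVec, mul_nonsing_inv _ hPD.det_pos.ne'.isUnit, one_mulVec]
  have hAb : A *ᵥ b = Xᵀ *ᵥ (X *ᵥ b) + lam • b := by
    rw [hA, add_mulVec, mulVec_mulVec, smul_mulVec, one_mulVec]
  have hX : ∀ (v : Fin k → ℝ) (w : Fin n → ℝ), v ⬝ᵥ (Xᵀ *ᵥ w) = w ⬝ᵥ (X *ᵥ v) := by
    intro v w
    rw [dotProduct_mulVec, vecMul_transpose, dotProduct_comm]
  have hAT : Aᵀ = A := by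
    rw [hA]; simp
  have hmb : m ⬝ᵥ (A *ᵥ b) = b ⬝ᵥ (A *ᵥ m) := by
    rw [dotProduct_mulVec, ← mulVec_transpose, hAT, dotProduct_comm]
  have e1 : (b - m) ⬝ᵥ (A *ᵥ (b - m)) = b ⬝ᵥ (A *ᵥ b) - 2 * (b ⬝ᵥ (A *ᵥ m)) + m ⬝ᵥ (A *ᵥ m) := by
    rw [mulVec_sub, sub_dotProduct, dotProduct_sub, dotProduct_sub, hmb]
    ring
  rw [e1, hAm, hAb, dotProduct_add, hX, hX, hX, dotProduct_smul, sub_dotProduct, dotProduct_sub,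
    dotProduct_sub, dotProduct_comm (X *ᵥ b) z, smul_eq_mul]
  ring

lemma R_pos {n k : ℕ} (X : Matrix (Fin n) (Fin k) ℝ) {lam : ℝ} (hlam : 0 < lam)
    (z : Fin n → ℝ) (hz : z ≠ 0) (A : Matrix (Fin k) (Fin k) ℝ)
    (hA : A = Xᵀ * X + lam • (1 : Matrix (Fin k) (Fin k) ℝ)) :
    0 < z ⬝ᵥ z - z ⬝ᵥ (X *ᵥ (A⁻¹ *ᵥ (Xᵀ *ᵥ z))) := by
  have h := complete_sq X hlam z A hA (A⁻¹ *ᵥ (Xᵀ *ᵥ z))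
  rw [sub_self, zero_dotProduct, zero_add] at h
  rw [← h]
  have nn : ∀ {l : ℕ} (v : Fin l → ℝ), 0 ≤ v ⬝ᵥ v := fun v =>
    Finset.sum_nonneg fun i _ => mul_self_nonneg _
  generalize A⁻¹ *ᵥ (Xᵀ *ᵥ z) = m
  by_cases hm : m = 0
  · subst hm
    simp only [mulVec_zero, sub_zero, dotProduct_zero, mul_zero, add_zero]
    exact lt_of_le_of_ne (nn z) fun h => hz (dotProduct_self_eq_zero.mp h.symm)
  · have : 0 < m ⬝ᵥ m := lt_of_le_of_ne (nn m) fun h => hm (dotProduct_self_eq_zero.mp h.symm)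
    have := nn (z - X *ᵥ m)
    positivity

lemma center_sq {n : ℕ} (hn : 2 ≤ n) (y w : Fin n → ℝ) (hw : ∑ i, w i = 0) (b0 : ℝ) :
    ∑ i, (y i - b0 - w i) ^ 2 = n * (b0 - (∑ m, y m) / n) ^ 2 +
      ((fun i => y i - (∑ m, y m) / n) - w) ⬝ᵥ ((fun i => y i - (∑ m, y m) / n) - w) := by
  have hn0 : (n : ℝ) ≠ 0 := by positivity
  set c := (∑ m, y m) / n with hc
  have hs : ∑ i, (y i - c - w i) = 0 := by
    rw [Finset.sum_sub_distrib, Finset.sum_sub_distrib, hw, hc]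
    simp; field_simp; ring
  have : ∀ i, (y i - b0 - w i) ^ 2 =
      (b0 - c) ^ 2 + (y i - c - w i) * (y i - c - w i) - 2 * (b0 - c) * (y i - c - w i) := by
    intro i; ring
  simp_rw [this]
  rw [Finset.sum_sub_distrib, Finset.sum_add_distrib, ← Finset.mul_sum, hs]
  simp [dotProduct]

lemma inner_int {n k : ℕ} (hn : 2 ≤ n)
    (X : Matrix (Fin n) (Fin k) ℝ) {lam : ℝ} (hlam : 0 < lam)
    (y : Fin n → ℝ) (hXcent : ∀ j, ∑ i, X i j = 0) (z : Fin n → ℝ)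
    (hz : z = fun i => y i - (∑ m, y m) / n) (A : Matrix (Fin k) (Fin k) ℝ)
    (hA : A = Xᵀ * X + lam • (1 : Matrix (Fin k) (Fin k) ℝ)) {s : ℝ} (hs : 0 < s) :
    (∫ b : Fin k → ℝ, ∫ b0 : ℝ,
        (2 * π * s) ^ (-(n : ℝ) / 2) *
          Real.exp (-(∑ i, (y i - b0 - (X *ᵥ b) i) ^ 2) / (2 * s)) *
        ((lam / (2 * π * s)) ^ ((k : ℝ) / 2) *
          Real.exp (-(lam * ∑ j, (b j) ^ 2) / (2 * s))) * (1 / s)) =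
    ((2 * π) ^ (-(((n : ℝ) - 1) / 2)) * (n : ℝ) ^ (-(1 : ℝ) / 2) * lam ^ ((k : ℝ) / 2) *
      A.det ^ (-(1 : ℝ) / 2)) * (s ^ (-(((n : ℝ) - 1) / 2)) * (1 / s) *
      Real.exp (-((z ⬝ᵥ z - z ⬝ᵥ (X *ᵥ (A⁻¹ *ᵥ (Xᵀ *ᵥ z)))) / 2) / s)) := by
  have hn0 : (0 : ℝ) < n := by positivity
  set R := z ⬝ᵥ z - z ⬝ᵥ (X *ᵥ (A⁻¹ *ᵥ (Xᵀ *ᵥ z))) with hR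
  set m := A⁻¹ *ᵥ (Xᵀ *ᵥ z) with hm
  set C := (2 * π * s) ^ (-(n : ℝ) / 2) * (lam / (2 * π * s)) ^ ((k : ℝ) / 2) * (1 / s) *
    Real.exp (-(R / 2) / s) with hC
  have h1 : ∀ (b : Fin k → ℝ) (b0 : ℝ), (2 * π * s) ^ (-(n : ℝ) / 2) *
          Real.exp (-(∑ i, (y i - b0 - (X *ᵥ b) i) ^ 2) / (2 * s)) *
        ((lam / (2 * π * s)) ^ ((k : ℝ) / 2) *
          Real.exp (-(lam * ∑ j, (b j) ^ 2) / (2 * s))) * (1 / s) =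
      (C * Real.exp (-(1 / (2 * s) * ((b - m) ⬝ᵥ (A *ᵥ (b - m)))))) *
        Real.exp (-(n / (2 * s)) * (b0 - (∑ m, y m) / n) ^ 2) := by
    intro b b0
    have hw : ∑ i, (X *ᵥ b) i = 0 := by
      simp only [mulVec, dotProduct]
      rw [Finset.sum_comm]
      simp_rw [← Finset.sum_mul, hXcent]
      simp
    have e1 := center_sq hn y (X *ᵥ b) hw b0
    rw [← hz] at e1
    have e2 := complete_sq X hlam z A hA b
    rw [← hm, ← hR] at e2
    have e3 : ∑ j, (b j) ^ 2 = b ⬝ᵥ b := by simp [dotProduct, pow_two]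
    have e4 : Real.exp (-(∑ i, (y i - b0 - (X *ᵥ b) i) ^ 2) / (2 * s)) *
        Real.exp (-(lam * ∑ j, (b j) ^ 2) / (2 * s)) =
        Real.exp (-(R / 2) / s) * Real.exp (-(1 / (2 * s) * ((b - m) ⬝ᵥ (A *ᵥ (b - m))))) *
        Real.exp (-(n / (2 * s)) * (b0 - (∑ m, y m) / n) ^ 2) := by
      rw [← Real.exp_add, ← Real.exp_add, ← Real.exp_add, e1, e3]
      congr 1
      linear_combination (-1 / (2 * s)) * e2
    rw [hC]
    linear_combination ((2 * π * s) ^ (-(n : ℝ) / 2) * (lam / (2 * π * s)) ^ ((k : ℝ) / 2) *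
      (1 / s)) * e4
  simp_rw [h1, integral_const_mul]
  rw [integral_mul_const, integral_const_mul, gauss_A (hA ▸ posDef_A X hlam) m (by positivity),
    integral_sub_right_eq_self (fun b0 : ℝ => Real.exp (-(n / (2 * s)) * b0 ^ 2)),
    integral_gaussian, hC]
  have p1 : π / (1 / (2 * s)) = 2 * π * s := by field_simp
  have p2 : π / (n / (2 * s)) = (2 * π * s) * (n : ℝ)⁻¹ := by field_simp
  have hps : 0 < 2 * π * s := by positivity
  rw [p1, p2, Real.sqrt_eq_rpow, Real.mul_rpow hps.le (by positivity),
    Real.div_rpow hlam.le hps.le, Real.inv_rpow hn0.le, neg_div 2 (1 : ℝ), Real.rpow_neg hn0.le,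
    ← Real.rpow_neg hn0.le]
  have p3 : (2 * π) ^ (-(((n : ℝ) - 1) / 2)) * s ^ (-(((n : ℝ) - 1) / 2)) =
      (2 * π * s) ^ (-(n : ℝ) / 2) * (2 * π * s) ^ ((1 : ℝ) / 2) := by
    rw [← Real.mul_rpow (by positivity) hs.le, ← Real.rpow_add hps]
    congr 1; ring
  have p4 : (2 * π * s) ^ ((k : ℝ) / 2) ≠ 0 := (Real.rpow_pos_of_pos hps _).ne'
  generalize (2 * π * s) ^ ((k : ℝ) / 2) = u at *
  have p5 : lam ^ ((k : ℝ) / 2) / u * u = lam ^ ((k : ℝ) / 2) := div_mul_cancel₀ _ p4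
  linear_combination ((2 * π * s) ^ (-(n : ℝ) / 2) * (2 * π * s) ^ ((1 : ℝ) / 2) *
      (n : ℝ) ^ (-((1 : ℝ) / 2)) * A.det ^ (-((1 : ℝ) / 2)) * (1 / s) *
      Real.exp (-(R / 2) / s)) * p5 - ((n : ℝ) ^ (-((1 : ℝ) / 2)) * lam ^ ((k : ℝ) / 2) *
      A.det ^ (-((1 : ℝ) / 2)) * (1 / s) * Real.exp (-(R / 2) / s)) * p3

/-- **Closed form of the marginal likelihood integral.** For an `n × k` design matrix `X`
with centered columns, `λ > 0` and data `y` which is not a constant vector, integrating the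
Gaussian likelihood against the normal prior on `β` and the improper prior `1/σ²` on
`(β₀, σ²)` gives `Γ((n−1)/2) π^{−(n−1)/2} n^{−1/2} λ^{k/2} det(XᵀX + λI)^{−1/2} R^{−(n−1)/2}`. -/
theorem marginal_likelihood_closed_form
    (n k : ℕ) (hn : 2 ≤ n)
    (X : Matrix (Fin n) (Fin k) ℝ) (lam : ℝ) (hlam : 0 < lam)
    (y : Fin n → ℝ)
    (hXcent : ∀ j, ∑ i, X i j = 0)
    (hy : ∀ c : ℝ, y ≠ fun _ => c) :
    (∫ s in Set.Ioi (0 : ℝ), ∫ b : Fin k → ℝ, ∫ b0 : ℝ,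
        (2 * π * s) ^ (-(n : ℝ) / 2) *
          Real.exp (-(∑ i, (y i - b0 - (X *ᵥ b) i) ^ 2) / (2 * s)) *
        ((lam / (2 * π * s)) ^ ((k : ℝ) / 2) *
          Real.exp (-(lam * ∑ j, (b j) ^ 2) / (2 * s))) * (1 / s)) =
      Real.Gamma (((n : ℝ) - 1) / 2) * π ^ (-(((n : ℝ) - 1) / 2)) *
        (n : ℝ) ^ (-(1 : ℝ) / 2) * lam ^ ((k : ℝ) / 2) *
        (Xᵀ * X + lam • (1 : Matrix (Fin k) (Fin k) ℝ)).det ^ (-(1 : ℝ) / 2) *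
        ((fun i => y i - (∑ m, y m) / n) ⬝ᵥ (fun i => y i - (∑ m, y m) / n) -
          (fun i => y i - (∑ m, y m) / n) ⬝ᵥ
            (X *ᵥ ((Xᵀ * X + lam • (1 : Matrix (Fin k) (Fin k) ℝ))⁻¹ *ᵥ
              (Xᵀ *ᵥ fun i => y i - (∑ m, y m) / n)))) ^ (-(((n : ℝ) - 1) / 2)) := by
  have hn0 : (0 : ℝ) < n := by positivity
  have ha : 0 < ((n : ℝ) - 1) / 2 := by
    have : (2 : ℝ) ≤ n := by exact_mod_cast hn
    linarith
  have hz : (fun i => y i - (∑ m, y m) / n) ≠ 0 := by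
    intro h
    refine hy ((∑ m, y m) / n) (funext fun i => ?_)
    have := congrFun h i
    simp only [Pi.zero_apply] at this
    linarith
  have hR := R_pos X hlam _ hz _ rfl
  rw [setIntegral_congr_fun measurableSet_Ioi fun s hs =>
    inner_int hn X hlam y hXcent _ rfl _ rfl (s := s) hs, integral_const_mul,
    inv_gamma ha (half_pos hR)]
  generalize (fun i => y i - (∑ m, y m) / n) ⬝ᵥ (fun i => y i - (∑ m, y m) / n) -
          (fun i => y i - (∑ m, y m) / n) ⬝ᵥ
            (X *ᵥ ((Xᵀ * X + lam • (1 : Matrix (Fin k) (Fin k) ℝ))⁻¹ *ᵥ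
              (Xᵀ *ᵥ fun i => y i - (∑ m, y m) / n))) = R at *
  have h2 : (2 * π) ^ (-(((n : ℝ) - 1) / 2)) * (R / 2) ^ (-(((n : ℝ) - 1) / 2)) =
      π ^ (-(((n : ℝ) - 1) / 2)) * R ^ (-(((n : ℝ) - 1) / 2)) := by
    rw [← Real.mul_rpow (by positivity) (by positivity), ← Real.mul_rpow (by positivity) hR.le]
    congr 1; ring
  generalize (Xᵀ * X + lam • (1 : Matrix (Fin k) (Fin k) ℝ)).det ^ (-(1 : ℝ) / 2) = D
  generalize (n : ℝ) ^ (-(1 : ℝ) / 2) = N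
  linear_combination (N * lam ^ ((k : ℝ) / 2) * D * Real.Gamma (((n : ℝ) - 1) / 2)) * h2
end
end

section
/- (Schur complement eigenvalue bound) Let H be a real symmetric positive definite matrix partitioned in block form H = [[H₁₁, H₁₂], [H₁₂^T, H₂₂]] with H₁₁ a square block. Then the minimum eigenvalue of the Schur complement H₂₂ − H₁₂^T H₁₁^{−1} H₁₂ is at least the minimum eigenvalue of H. -/
open Matrix

noncomputable section

/-- Minimum eigenvalue of a symmetric real matrix, as the infimum of the Rayleigh
quotient over unit vectors. -/
def minEig {m : Type*} [Fintype m] (M : Matrix m m ℝ) : ℝ :=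
  ⨅ v : {v : m → ℝ // v ⬝ᵥ v = 1}, ((v : m → ℝ) ⬝ᵥ (M *ᵥ (v : m → ℝ)))

/-- **Schur complement eigenvalue bound.** If `H = [[H₁₁, H₁₂], [H₁₂ᵀ, H₂₂]]` is symmetric
positive definite, then the minimum eigenvalue of the Schur complement
`H₂₂ − H₁₂ᵀ H₁₁⁻¹ H₁₂` is at least the minimum eigenvalue of `H`. -/
theorem schur_complement_minEig_bound
    {m k : Type*} [Fintype m] [Fintype k] [DecidableEq m] [DecidableEq k] [Nonempty k]
    (H₁₁ : Matrix m m ℝ) (H₁₂ : Matrix m k ℝ) (H₂₂ : Matrix k k ℝ)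
    (hH : (Matrix.fromBlocks H₁₁ H₁₂ H₁₂ᵀ H₂₂).PosDef) :
    minEig (Matrix.fromBlocks H₁₁ H₁₂ H₁₂ᵀ H₂₂) ≤ minEig (H₂₂ - H₁₂ᵀ * H₁₁⁻¹ * H₁₂) := by
  have hnn : ∀ w : m ⊕ k → ℝ,
      0 ≤ w ⬝ᵥ (Matrix.fromBlocks H₁₁ H₁₂ H₁₂ᵀ H₂₂ *ᵥ w) := by
    intro w
    simpa using hH.posSemidef.dotProduct_mulVec_nonneg w
  have h11 : H₁₁.PosDef := by
    have h := hH.submatrix (e := (Sum.inl : m → m ⊕ k)) Sum.inl_injective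
    exact h
  have hdet : IsUnit H₁₁.det := (Matrix.isUnit_iff_isUnit_det _).mp h11.isUnit
  have hne : Nonempty {v : k → ℝ // v ⬝ᵥ v = 1} := by
    obtain ⟨i⟩ := ‹Nonempty k›
    exact ⟨⟨Pi.single i 1, by simp⟩⟩
  unfold minEig
  refine le_ciInf ?_
  rintro ⟨v, hv⟩
  obtain ⟨x, hx⟩ : ∃ x : m → ℝ, x = -(H₁₁⁻¹ *ᵥ (H₁₂ *ᵥ v)) := ⟨_, rfl⟩
  obtain ⟨w, hw⟩ : ∃ w : m ⊕ k → ℝ, w = Sum.elim x v := ⟨_, rfl⟩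
  have hq : w ⬝ᵥ (Matrix.fromBlocks H₁₁ H₁₂ H₁₂ᵀ H₂₂ *ᵥ w)
      = v ⬝ᵥ ((H₂₂ - H₁₂ᵀ * H₁₁⁻¹ * H₁₂) *ᵥ v) := by
    have e1 : H₁₁ *ᵥ x + H₁₂ *ᵥ v = 0 := by
      rw [hx, Matrix.mulVec_neg, Matrix.mulVec_mulVec, Matrix.mul_nonsing_inv _ hdet]
      simp
    have e2 : H₁₂ᵀ *ᵥ x + H₂₂ *ᵥ v = (H₂₂ - H₁₂ᵀ * H₁₁⁻¹ * H₁₂) *ᵥ v := by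
      rw [hx, Matrix.mulVec_neg, Matrix.sub_mulVec, Matrix.mulVec_mulVec, Matrix.mulVec_mulVec,
        neg_add_eq_sub, Matrix.mul_assoc]
    rw [hw, Matrix.fromBlocks_mulVec]
    simp only [Sum.elim_comp_inl, Sum.elim_comp_inr]
    rw [e1, e2, sumElim_dotProduct_sumElim]
    simp
  have hc : 1 ≤ w ⬝ᵥ w := by
    rw [hw, sumElim_dotProduct_sumElim, hv]
    have : 0 ≤ x ⬝ᵥ x := Finset.sum_nonneg fun i _ => mul_self_nonneg _
    linarith
  have hq0 := hnn w
  obtain ⟨c, hcd⟩ : ∃ c : ℝ, c = w ⬝ᵥ w := ⟨_, rfl⟩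
  rw [← hcd] at hc
  have hss : (Real.sqrt c)⁻¹ * (Real.sqrt c)⁻¹ = c⁻¹ := by
    rw [← mul_inv, Real.mul_self_sqrt (by linarith)]
  have hunit : ((Real.sqrt c)⁻¹ • w) ⬝ᵥ ((Real.sqrt c)⁻¹ • w) = 1 := by
    rw [smul_dotProduct, dotProduct_smul, smul_eq_mul, smul_eq_mul, ← mul_assoc, hss, ← hcd]
    exact inv_mul_cancel₀ (by linarith)
  refine (ciInf_le ⟨0, ?_⟩ ⟨(Real.sqrt c)⁻¹ • w, hunit⟩).trans ?_
  · rintro _ ⟨u, rfl⟩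
    exact hnn _
  · simp only
    rw [Matrix.mulVec_smul, smul_dotProduct, dotProduct_smul, smul_eq_mul, smul_eq_mul,
      ← mul_assoc, hss, ← hq]
    exact mul_le_of_le_one_left hq0 (inv_le_one_of_one_le₀ hc)
end
end

section
/- (Ridge versus least-squares residual comparison) Let X be a nonzero n×k real matrix, let P be the orthogonal projection onto the column space of X, let α > 0 be the minimum nonzero eigenvalue of X^T X, and let λ > 0. Then (I_n + λ^{−1}XX^T)^{−1} − (I_n − P) = λ · P (XX^T + λI_n)^{−1} P, and consequently, for every y ∈ ℝ^n, 0 ≤ y^T (I_n + λ^{−1}XX^T)^{−1} y − y^T (I_n − P) y ≤ (λ/(λ + α)) · y^T P y. -/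
open Matrix

noncomputable section

theorem key_aux (k : ℕ) (G : Matrix (Fin k) (Fin k) ℝ) (hG : G.PosSemidef) (α : ℝ)
    (hmin : ∀ r : ℝ, r ≠ 0 → Module.End.HasEigenvalue (Matrix.toLin' G) r → α ≤ r)
    (c : Fin k → ℝ) : α * (c ⬝ᵥ (G *ᵥ c)) ≤ (G *ᵥ c) ⬝ᵥ (G *ᵥ c) := by
  have hH := hG.isHermitian
  have hT : Gᵀ = G := by simpa [Matrix.IsHermitian, conjTranspose_eq_transpose_of_trivial] using hH
  set b := hH.eigenvectorBasis with hb
  have hbi : ∀ i, G *ᵥ (b i).ofLp = hH.eigenvalues i • (b i).ofLp := fun i => by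
    simpa using hH.mulVec_eigenvectorBasis i
  have hin : ∀ u v : Fin k → ℝ, u ⬝ᵥ v = ∑ i, (u ⬝ᵥ (b i).ofLp) * ((b i).ofLp ⬝ᵥ v) := by
    intro u v
    have := b.sum_inner_mul_inner (WithLp.toLp 2 u) (WithLp.toLp 2 v)
    simp only [EuclideanSpace.inner_eq_star_dotProduct, star_trivial] at this
    rw [dotProduct_comm u v, ← this]
    refine Finset.sum_congr rfl fun i _ => ?_
    rw [dotProduct_comm u, dotProduct_comm v]
  have hGb : ∀ i, (b i).ofLp ⬝ᵥ (G *ᵥ c) = hH.eigenvalues i * ((b i).ofLp ⬝ᵥ c) := by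
    intro i
    rw [dotProduct_mulVec, ← mulVec_transpose, hT, hbi, smul_dotProduct, smul_eq_mul]
  rw [hin c, hin (G *ᵥ c), Finset.mul_sum]
  refine Finset.sum_le_sum fun i _ => ?_
  rw [dotProduct_comm (G *ᵥ c), hGb, dotProduct_comm c]
  set g := hH.eigenvalues i with hg
  have hg0 : 0 ≤ g := hG.eigenvalues_nonneg i
  have hle : 0 ≤ g * (g - α) := by
    by_cases h : g = 0
    · simp [h]
    · refine mul_nonneg hg0 (sub_nonneg.2 (hmin g h ?_))
      refine Module.End.hasEigenvalue_of_hasEigenvector (x := (b i).ofLp) ?_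
      refine ⟨Module.End.mem_eigenspace_iff.2 (by simpa using hbi i), fun h0 => ?_⟩
      exact b.toBasis.ne_zero i (by ext j; simpa using congrFun h0 j)
  nlinarith [mul_nonneg hle (sq_nonneg ((b i).ofLp ⬝ᵥ c))]

/-- **Ridge versus least-squares residual comparison.** Let `X : n × k` be nonzero, `P` the
orthogonal projection matrix onto the column space of `X` (characterized by being symmetric,
idempotent, fixing the columns of `X`, and mapping into the column space), `α > 0` the
minimum nonzero eigenvalue of `XᵀX`, and `λ > 0`. Then
`(I + λ⁻¹XXᵀ)⁻¹ − (I − P) = λ P(XXᵀ + λI)⁻¹P`, and for every `y`,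
`0 ≤ yᵀ(I + λ⁻¹XXᵀ)⁻¹y − yᵀ(I − P)y ≤ (λ/(λ+α)) yᵀPy`. -/
theorem ridge_vs_ols_residual_comparison (n k : ℕ)
    (X : Matrix (Fin n) (Fin k) ℝ) (hX : X ≠ 0)
    (P : Matrix (Fin n) (Fin n) ℝ)
    -- P is the orthogonal projection onto the column space of X
    (hPsymm : Pᵀ = P) (hPidem : P * P = P) (hPX : P * X = X)
    (hPrange : ∀ y : Fin n → ℝ, ∃ c : Fin k → ℝ, P *ᵥ y = X *ᵥ c)
    -- α is the minimum nonzero eigenvalue of XᵀX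
    (α : ℝ) (hα : 0 < α)
    (hαeig : Module.End.HasEigenvalue (Matrix.toLin' (Xᵀ * X)) α)
    (hαmin : ∀ r : ℝ, r ≠ 0 → Module.End.HasEigenvalue (Matrix.toLin' (Xᵀ * X)) r → α ≤ r)
    (lam : ℝ) (hlam : 0 < lam) :
    (((1 : Matrix (Fin n) (Fin n) ℝ) + lam⁻¹ • (X * Xᵀ))⁻¹ -
        ((1 : Matrix (Fin n) (Fin n) ℝ) - P) =
      lam • (P * (X * Xᵀ + lam • (1 : Matrix (Fin n) (Fin n) ℝ))⁻¹ * P)) ∧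
    (∀ y : Fin n → ℝ,
      0 ≤ y ⬝ᵥ (((1 : Matrix (Fin n) (Fin n) ℝ) + lam⁻¹ • (X * Xᵀ))⁻¹ *ᵥ y) -
          y ⬝ᵥ (((1 : Matrix (Fin n) (Fin n) ℝ) - P) *ᵥ y) ∧
      y ⬝ᵥ (((1 : Matrix (Fin n) (Fin n) ℝ) + lam⁻¹ • (X * Xᵀ))⁻¹ *ᵥ y) -
          y ⬝ᵥ (((1 : Matrix (Fin n) (Fin n) ℝ) - P) *ᵥ y) ≤
        (lam / (lam + α)) * (y ⬝ᵥ (P *ᵥ y))) := by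
  set A := X * Xᵀ with hA
  set S := A + lam • (1 : Matrix (Fin n) (Fin n) ℝ) with hS
  have hAT : Aᵀ = A := by simp [hA]
  have hApsd : A.PosSemidef := by
    simpa [hA, conjTranspose_eq_transpose_of_trivial] using posSemidef_self_mul_conjTranspose X
  have hGpsd : (Xᵀ * X).PosSemidef := by
    simpa [conjTranspose_eq_transpose_of_trivial] using posSemidef_conjTranspose_mul_self X
  have hSpd : S.PosDef := PosDef.posSemidef_add hApsd (PosDef.one.smul hlam)
  have hdet : IsUnit S.det := (Matrix.isUnit_iff_isUnit_det _).1 hSpd.isUnit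
  have hSM : S * S⁻¹ = 1 := mul_nonsing_inv _ hdet
  have hMS : S⁻¹ * S = 1 := nonsing_inv_mul _ hdet
  have hinv : ((1 : Matrix (Fin n) (Fin n) ℝ) + lam⁻¹ • A)⁻¹ = lam • S⁻¹ := by
    apply inv_eq_right_inv
    have : (1 : Matrix (Fin n) (Fin n) ℝ) + lam⁻¹ • A = lam⁻¹ • S := by
      rw [hS, smul_add, smul_smul, inv_mul_cancel₀ hlam.ne', one_smul, add_comm]
    rw [this, smul_mul_smul_comm, inv_mul_cancel₀ hlam.ne', hSM, one_smul]
  have hPA : P * A = A := by rw [hA, ← Matrix.mul_assoc, hPX]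
  have hAP : A * P = A := by
    have := congrArg transpose hPA
    rwa [transpose_mul, hAT, hPsymm] at this
  have hPS : P * S = S * P := by
    simp [hS, Matrix.mul_add, Matrix.add_mul, hPA, hAP]
  have hPM : P * S⁻¹ = S⁻¹ * P := by
    calc P * S⁻¹ = S⁻¹ * S * P * S⁻¹ := by rw [hMS, Matrix.one_mul]
      _ = S⁻¹ * (S * P) * S⁻¹ := by simp only [Matrix.mul_assoc]
      _ = S⁻¹ * P * (S * S⁻¹) := by rw [← hPS]; simp only [Matrix.mul_assoc]
      _ = S⁻¹ * P := by rw [hSM, Matrix.mul_one]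
  have hQ : lam • (S⁻¹ * (1 - P)) = 1 - P := by
    have : S * (1 - P) = lam • (1 - P) := by
      simp [hS, Matrix.mul_sub, Matrix.add_mul, hAP, smul_sub]
    rw [← Matrix.mul_smul, ← this, ← Matrix.mul_assoc, hMS, Matrix.one_mul]
  have hmain : ((1 : Matrix (Fin n) (Fin n) ℝ) + lam⁻¹ • A)⁻¹ - (1 - P)
      = lam • (P * S⁻¹ * P) := by
    rw [hinv, hPM, Matrix.mul_assoc, hPidem]
    nth_rewrite 1 [← hQ]
    rw [← smul_sub, Matrix.mul_sub, Matrix.mul_one, sub_sub_cancel]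
  refine ⟨hmain, fun y => ?_⟩
  rw [← dotProduct_sub, ← sub_mulVec, hmain]
  obtain ⟨w, hw⟩ : ∃ w, w = S⁻¹ *ᵥ (P *ᵥ y) := ⟨_, rfl⟩
  have hSw : S *ᵥ w = P *ᵥ y := by rw [hw, mulVec_mulVec, hSM, one_mulVec]
  have hPw : w = P *ᵥ (S⁻¹ *ᵥ y) := by
    rw [hw, mulVec_mulVec, mulVec_mulVec, hPM]
  have hPdot : ∀ v : Fin n → ℝ, y ⬝ᵥ (P *ᵥ v) = (P *ᵥ y) ⬝ᵥ v := by
    intro v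
    rw [dotProduct_mulVec, ← mulVec_transpose, hPsymm]
  have h1 : y ⬝ᵥ ((lam • (P * S⁻¹ * P)) *ᵥ y) = lam * ((S *ᵥ w) ⬝ᵥ w) := by
    rw [smul_mulVec, dotProduct_smul, smul_eq_mul, ← mulVec_mulVec, ← mulVec_mulVec, hPdot,
      ← hw, hSw]
  have h2 : y ⬝ᵥ (P *ᵥ y) = (S *ᵥ w) ⬝ᵥ (S *ᵥ w) := by
    rw [hSw, ← hPdot, mulVec_mulVec, hPidem]
  have hSw' : S *ᵥ w = A *ᵥ w + lam • w := by
    rw [hS, add_mulVec, smul_mulVec, one_mulVec]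
  obtain ⟨c, hc⟩ := hPrange (S⁻¹ *ᵥ y)
  rw [← hPw] at hc
  have hXdot : ∀ (u : Fin k → ℝ) (v : Fin n → ℝ), (X *ᵥ u) ⬝ᵥ v = u ⬝ᵥ (Xᵀ *ᵥ v) := by
    intro u v
    rw [dotProduct_mulVec, vecMul_transpose]
  have hkey : α * (w ⬝ᵥ w) ≤ (A *ᵥ w) ⬝ᵥ w := by
    have := key_aux k (Xᵀ * X) hGpsd α hαmin c
    have e1 : c ⬝ᵥ ((Xᵀ * X) *ᵥ c) = w ⬝ᵥ w := by
      rw [← mulVec_mulVec, ← hXdot, ← hc]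
    have e2 : (A *ᵥ w) ⬝ᵥ w = ((Xᵀ * X) *ᵥ c) ⬝ᵥ ((Xᵀ * X) *ᵥ c) := by
      rw [hA, ← mulVec_mulVec, hXdot, ← mulVec_mulVec, ← hc]
    rw [e2, ← e1]; exact this
  have hww : 0 ≤ w ⬝ᵥ w := by simpa using dotProduct_star_self_nonneg w
  have hsq : 0 ≤ (A *ᵥ w - α • w) ⬝ᵥ (A *ᵥ w - α • w) := by
    simpa using dotProduct_star_self_nonneg (A *ᵥ w - α • w)
  rw [h1, h2, hSw']
  simp only [sub_dotProduct, dotProduct_sub, add_dotProduct, dotProduct_add, smul_dotProduct,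
    dotProduct_smul, smul_eq_mul, dotProduct_comm w (A *ᵥ w)] at hsq ⊢
  generalize w ⬝ᵥ w = a at *
  generalize (A *ᵥ w) ⬝ᵥ w = b at *
  generalize (A *ᵥ w) ⬝ᵥ (A *ᵥ w) = d at *
  have hb : 0 ≤ b := le_trans (by positivity) hkey
  have hd : α * b ≤ d := by nlinarith
  refine ⟨by positivity, ?_⟩
  rw [div_mul_eq_mul_div, le_div_iff₀ (by positivity), mul_assoc]
  refine mul_le_mul_of_nonneg_left ?_ hlam.le
  nlinarith [mul_le_mul_of_nonneg_left hkey hlam.le]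
end
end
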